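/- Let $f$ satisfy conditions (A1)-(A4): $f(t,\cdot,\cdot)$ continuous, $f(\cdot,x,z)$ Borel measurable, $\|f(t,x,z)\|\leq K(t)(1+\|x\|)(1+\|z\|)$ with $K\in L^1([0,(n+1)\tau])$, and a local Lipschitz condition in $x$ with $L^1$ weight. Then the delay differential equation $x'(t)=f(t,x(t),x(t-\tau))$ on $[0,(n+1)\tau]$ with $x(t)=x_0$ for $t\in[-\tau,0]$ has a unique absolutely continuous solution. -/

import Mathlib

open MeasureTheory Set

/-- `x` is a (Carathéodory/absolutely continuous, in integral form) solution of the DDE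
`x'(t) = f(t, x(t), x(t-τ))` on `[0,(n+1)τ]` with `x ≡ x₀` on `[-τ,0]`. -/
def IsDDESolution (d n : ℕ) (τ : ℝ)
    (f : ℝ → EuclideanSpace ℝ (Fin d) → EuclideanSpace ℝ (Fin d) → EuclideanSpace ℝ (Fin d))
    (x₀ : EuclideanSpace ℝ (Fin d)) (x : ℝ → EuclideanSpace ℝ (Fin d)) : Prop :=
  (∀ t ∈ Icc (-τ) (0:ℝ), x t = x₀) ∧
  IntegrableOn (fun s => f s (x s) (x (s - τ))) (Icc (0:ℝ) ((n+1)*τ)) ∧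
  ∀ t ∈ Icc (0:ℝ) ((n+1)*τ), x t = x₀ + ∫ s in (0:ℝ)..t, f s (x s) (x (s - τ))


theorem dde_weight {L : ℝ → ℝ} (hL : Integrable L) (hL0 : ∀ t, 0 ≤ L t) {t : ℝ} (ht : 0 ≤ t) :
    ∫ s in (0:ℝ)..t, L s * Real.exp (2 * ∫ r in (0:ℝ)..s, L r) ≤
      Real.exp (2 * ∫ r in (0:ℝ)..t, L r) / 2 := by
  set Λ : ℝ → ℝ := fun s => ∫ r in (0:ℝ)..s, L r with hΛ
  have hmono : Monotone Λ := by
    intro a b hab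
    have h := intervalIntegral.integral_add_adjacent_intervals
      (hL.intervalIntegrable (a := 0) (b := a)) (hL.intervalIntegrable (a := a) (b := b))
    have h2 : 0 ≤ ∫ r in a..b, L r := intervalIntegral.integral_nonneg hab (fun u _ => hL0 u)
    simp only [hΛ]; linarith
  have hmono2 : Monotone (fun s => Real.exp (2 * Λ s)) := by
    intro a b hab
    exact Real.exp_le_exp.2 (by linarith [hmono hab])
  have h1 := (hmono2.monotoneOn (uIcc 0 t)).intervalIntegral_deriv_mem_uIcc
  have h2 : ∫ s in (0:ℝ)..t, deriv (fun s => Real.exp (2 * Λ s)) s =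
      ∫ s in (0:ℝ)..t, 2 * (L s * Real.exp (2 * Λ s)) := by
    apply intervalIntegral.integral_congr_ae
    filter_upwards [LocallyIntegrable.ae_hasDerivAt_integral hL.locallyIntegrable] with s hs _
    have := (((hs 0).const_mul 2).exp).deriv
    rw [this]; ring
  rw [h2, intervalIntegral.integral_const_mul,
    uIcc_of_le (by linarith [hmono2 ht] : (0:ℝ) ≤ Real.exp (2 * Λ t) - Real.exp (2 * Λ 0))] at h1
  have := h1.2
  have h3 := Real.exp_pos (2 * Λ 0)
  linarith

theorem dde_cont_prim {L : ℝ → ℝ} (hL : Integrable L) :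
    Continuous (fun s => ∫ r in (0:ℝ)..s, L r) :=
  intervalIntegral.continuous_primitive (fun _ _ => hL.intervalIntegrable) 0

theorem dde_gronwall {L u : ℝ → ℝ} (hL : Integrable L) (hL0 : ∀ t, 0 ≤ L t)
    (hu : Continuous u) {C b : ℝ} (hC : 0 ≤ C)
    (h : ∀ t ∈ Icc (0:ℝ) b, u t ≤ C + ∫ s in (0:ℝ)..t, L s * u s) :
    ∀ t ∈ Icc (0:ℝ) b, u t ≤ 2 * C * Real.exp (2 * ∫ r in (0:ℝ)..t, L r) := by
  intro t ht
  have hΛc := dde_cont_prim hL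
  have hw := fun {t : ℝ} (ht : 0 ≤ t) => dde_weight hL hL0 ht
  have hΛ0 : ∀ t, 0 ≤ t → 0 ≤ ∫ r in (0:ℝ)..t, L r := fun t ht =>
    intervalIntegral.integral_nonneg ht (fun u _ => hL0 u)
  set Λ : ℝ → ℝ := fun s => ∫ r in (0:ℝ)..s, L r with hΛ
  have hvc : Continuous (fun s => u s * Real.exp (-(2 * Λ s))) := by fun_prop
  obtain ⟨m, hm, hmax⟩ := isCompact_Icc.exists_isMaxOn ⟨t, ht⟩ hvc.continuousOn
  set M := u m * Real.exp (-(2 * Λ m)) with hM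
  have hle : ∀ s ∈ Icc (0:ℝ) b, u s ≤ M * Real.exp (2 * Λ s) := by
    intro s hs
    have h1 : u s * Real.exp (-(2 * Λ s)) ≤ M := hmax hs
    rw [Real.exp_neg, ← div_eq_mul_inv, div_le_iff₀ (Real.exp_pos _)] at h1
    exact h1
  have hM2 : M ≤ 2 * C := by
    by_contra hcon
    push Not at hcon
    have hM0 : 0 ≤ M := by linarith
    have h1 : ∫ s in (0:ℝ)..m, L s * u s ≤ ∫ s in (0:ℝ)..m, M * (L s * Real.exp (2 * Λ s)) := by
      apply intervalIntegral.integral_mono_on hm.1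
      · exact hL.intervalIntegrable.mul_continuousOn hu.continuousOn
      · exact (hL.intervalIntegrable.mul_continuousOn (by fun_prop)).const_mul _
      · intro s hs
        have := mul_le_mul_of_nonneg_left (hle s ⟨hs.1, hs.2.trans hm.2⟩) (hL0 s)
        linarith
    rw [intervalIntegral.integral_const_mul] at h1
    have h2 := mul_le_mul_of_nonneg_left (hw hm.1) hM0
    have h3 := h m hm
    have h4 : u m = M * Real.exp (2 * Λ m) := by
      rw [hM, mul_assoc, ← Real.exp_add]; simp
    have h5 : 1 ≤ Real.exp (2 * Λ m) := Real.one_le_exp (by linarith [hΛ0 m hm.1])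
    have h6 : M * Real.exp (2 * Λ m) ≤ 2 * C := by
      simp only [← hΛ] at *
      linarith
    nlinarith
  exact (hle t ht).trans (mul_le_mul_of_nonneg_right hM2 (Real.exp_pos _).le)

section
variable {E : Type*} [NormedAddCommGroup E] [NormedSpace ℝ E] [CompleteSpace E]
  [MeasurableSpace E] [BorelSpace E] [SecondCountableTopology E]

theorem dde_meas {g : ℝ → E → E} (hc : ∀ t, Continuous (g t)) (hm : ∀ x, Measurable fun t => g t x)
    {x : ℝ → E} (hx : Measurable x) : Measurable fun s => g s (x s) := by
  have := measurable_uncurry_of_continuous_of_measurable (u := fun x t => g t x) hc hm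
  exact this.comp (hx.prodMk measurable_id)

theorem dde_int {g : ℝ → E → E} (hc : ∀ t, Continuous (g t)) (hm : ∀ x, Measurable fun t => g t x)
    {k : ℝ → ℝ} (hk : Integrable k)
    (hb : ∀ t x, ‖g t x‖ ≤ k t * (1 + ‖x‖)) {x : ℝ → E} (hx : Continuous x) (a b : ℝ) :
    IntervalIntegrable (fun s => g s (x s)) volume a b := by
  have h1 : IntervalIntegrable (fun s => k s * (1 + ‖x s‖)) volume a b :=
    hk.intervalIntegrable.mul_continuousOn (by fun_prop)
  exact h1.mono_fun' (dde_meas hc hm hx.measurable).aestronglyMeasurable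
    (Filter.Eventually.of_forall fun s => hb s (x s))

theorem dde_exist_lip {g : ℝ → E → E} (hc : ∀ t, Continuous (g t))
    (hm : ∀ x, Measurable fun t => g t x)
    {k L : ℝ → ℝ} (hk : Integrable k)
    (hb : ∀ t x, ‖g t x‖ ≤ k t * (1 + ‖x‖))
    (hL : Integrable L) (hL0 : ∀ t, 0 ≤ L t) (hlip : ∀ t x y, ‖g t x - g t y‖ ≤ L t * ‖x - y‖)
    (x₀ : E) {T : ℝ} (hT : 0 ≤ T) :
    ∃ y : ℝ → E, Continuous y ∧ (∀ t ≤ 0, y t = x₀) ∧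
      ∀ t ∈ Icc (0:ℝ) T, y t = x₀ + ∫ s in (0:ℝ)..t, g s (y s) := by
  have hΛc := dde_cont_prim hL
  have hw := fun {t : ℝ} (ht : 0 ≤ t) => dde_weight hL hL0 ht
  set Λ : ℝ → ℝ := fun s => ∫ r in (0:ℝ)..s, L r with hΛ
  let ex : C(Icc (0:ℝ) T, E) → ℝ → E := fun y s => Real.exp (2 * Λ s) • y (projIcc 0 T hT s)
  have hex : ∀ y, Continuous (ex y) := fun y =>
    (by fun_prop : Continuous fun s => Real.exp (2 * Λ s)).smul
      (y.continuous.comp continuous_projIcc)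
  have hI : ∀ y : C(Icc (0:ℝ) T, E), Continuous fun t => ∫ s in (0:ℝ)..t, g s (ex y s) := fun y =>
    intervalIntegral.continuous_primitive (fun a b => dde_int hc hm hk hb (hex y) a b) 0
  let F : C(Icc (0:ℝ) T, E) → C(Icc (0:ℝ) T, E) := fun y =>
    ⟨fun t => Real.exp (-(2 * Λ t)) • (x₀ + ∫ s in (0:ℝ)..t, g s (ex y s)), by
      have := hI y
      have h2 : Continuous fun t : ℝ =>
        Real.exp (-(2 * Λ t)) • (x₀ + ∫ s in (0:ℝ)..t, g s (ex y s)) := by fun_prop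
      exact h2.comp continuous_subtype_val⟩
  have hF : ContractingWith (1/2) F := by
    refine ⟨by rw [div_lt_iff₀] <;> norm_num, LipschitzWith.of_dist_le_mul fun y z => ?_⟩
    rw [ContinuousMap.dist_le (by positivity)]
    intro t
    have ht0 : (0:ℝ) ≤ t := t.2.1
    have h1 : F y t - F z t = Real.exp (-(2 * Λ t)) •
        (∫ s in (0:ℝ)..t, (g s (ex y s) - g s (ex z s))) := by
      rw [intervalIntegral.integral_sub (dde_int hc hm hk hb (hex y) _ _)
        (dde_int hc hm hk hb (hex z) _ _)]
      simp only [F, ContinuousMap.coe_mk]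
      rw [← smul_sub]; congr 1; abel
    have h2 : ‖∫ s in (0:ℝ)..t, (g s (ex y s) - g s (ex z s))‖ ≤
        ∫ s in (0:ℝ)..t, dist y z * (L s * Real.exp (2 * Λ s)) := by
      apply intervalIntegral.norm_integral_le_of_norm_le ht0
      · refine Filter.Eventually.of_forall fun s _ => ?_
        refine (hlip s _ _).trans ?_
        have h3 : ‖ex y s - ex z s‖ ≤ Real.exp (2 * Λ s) * dist y z := by
          simp only [ex]
          rw [← smul_sub, norm_smul, Real.norm_of_nonneg (Real.exp_pos _).le, ← dist_eq_norm]
          exact mul_le_mul_of_nonneg_left (ContinuousMap.dist_apply_le_dist _) (Real.exp_pos _).le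
        have := mul_le_mul_of_nonneg_left h3 (hL0 s)
        linarith
      · exact (hL.intervalIntegrable.mul_continuousOn (by fun_prop)).const_mul _
    rw [intervalIntegral.integral_const_mul] at h2
    have h3 := mul_le_mul_of_nonneg_left (hw ht0) (dist_nonneg (x := y) (y := z))
    rw [dist_eq_norm, h1, norm_smul, Real.norm_of_nonneg (Real.exp_pos _).le]
    have h4 := mul_le_mul_of_nonneg_left (h2.trans h3) (Real.exp_pos (-(2 * Λ t))).le
    refine h4.trans (le_of_eq ?_)
    have h5 : Real.exp (-(2 * Λ t)) * Real.exp (2 * Λ t) = 1 := by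
      rw [← Real.exp_add]; simp
    push_cast
    linear_combination (dist y z / 2) * h5
  have : Nonempty C(Icc (0:ℝ) T, E) := ⟨0⟩
  obtain ⟨y, hy⟩ : ∃ y, F y = y := ⟨_, hF.fixedPoint_isFixedPt⟩
  have key : ∀ t ∈ Icc (0:ℝ) T, ex y t = x₀ + ∫ s in (0:ℝ)..t, g s (ex y s) := by
    intro t ht
    have h1 : F y ⟨t, ht⟩ = y ⟨t, ht⟩ := by rw [hy]
    have h2 : ex y t = Real.exp (2 * Λ t) • y ⟨t, ht⟩ := by
      simp only [ex]; rw [projIcc_of_mem hT ht]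
    rw [h2, ← h1]
    simp only [F, ContinuousMap.coe_mk]
    rw [smul_smul, ← Real.exp_add]; simp
  refine ⟨fun t => ex y (projIcc 0 T hT t), (hex y).comp (continuous_subtype_val.comp
    continuous_projIcc), ?_, ?_⟩
  · intro t ht
    simp only [projIcc_of_le_left hT ht]
    rw [key 0 ⟨le_rfl, hT⟩]; simp
  · intro t ht
    have hp : ∀ s ∈ Icc (0:ℝ) T, (projIcc 0 T hT s : ℝ) = s := fun s hs => by
      rw [projIcc_of_mem hT hs]
    simp only [hp t ht]
    rw [key t ht]
    congr 1
    apply intervalIntegral.integral_congr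
    intro s hs
    rw [uIcc_of_le ht.1] at hs
    simp only [hp s ⟨hs.1, hs.2.trans ht.2⟩]

theorem dde_apriori {g : ℝ → E → E}
    {k : ℝ → ℝ} (hk : Integrable k) (hk0 : ∀ t, 0 ≤ k t)
    (hb : ∀ t x, ‖g t x‖ ≤ k t * (1 + ‖x‖)) (x₀ : E) {T : ℝ} {y : ℝ → E} (hy : Continuous y)
    (h : ∀ t ∈ Icc (0:ℝ) T, y t = x₀ + ∫ s in (0:ℝ)..t, g s (y s)) :
    ∀ t ∈ Icc (0:ℝ) T, ‖y t‖ ≤ 2 * (1 + ‖x₀‖) * Real.exp (2 * ∫ r, k r) := by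
  have h0 : ∀ t ∈ Icc (0:ℝ) T, 1 + ‖y t‖ ≤ 2 * (1 + ‖x₀‖) *
      Real.exp (2 * ∫ r in (0:ℝ)..t, k r) := by
    apply dde_gronwall hk hk0 (by fun_prop) (by positivity)
    intro t ht
    have h1 : ‖∫ s in (0:ℝ)..t, g s (y s)‖ ≤ ∫ s in (0:ℝ)..t, k s * (1 + ‖y s‖) :=
      intervalIntegral.norm_integral_le_of_norm_le ht.1
        (Filter.Eventually.of_forall fun s _ => hb s _)
        (hk.intervalIntegrable.mul_continuousOn (by fun_prop))
    have h2 := norm_add_le x₀ (∫ s in (0:ℝ)..t, g s (y s))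
    rw [← h t ht] at h2
    linarith
  intro t ht
  have h1 : ∫ r in (0:ℝ)..t, k r ≤ ∫ r, k r := by
    rw [intervalIntegral.integral_of_le ht.1]
    exact setIntegral_le_integral hk (Filter.Eventually.of_forall hk0)
  have h2 : Real.exp (2 * ∫ r in (0:ℝ)..t, k r) ≤ Real.exp (2 * ∫ r, k r) :=
    Real.exp_le_exp.2 (by linarith)
  have h3 := mul_le_mul_of_nonneg_left h2 (by positivity : 0 ≤ 2 * (1 + ‖x₀‖))
  linarith [h0 t ht]

theorem dde_exist {g : ℝ → E → E} (hc : ∀ t, Continuous (g t))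
    (hm : ∀ x, Measurable fun t => g t x)
    {k : ℝ → ℝ} (hk : Integrable k) (hk0 : ∀ t, 0 ≤ k t)
    (hb : ∀ t x, ‖g t x‖ ≤ k t * (1 + ‖x‖))
    (hlip : ∀ R : ℝ, ∃ L : ℝ → ℝ, Integrable L ∧ (∀ t, 0 ≤ L t) ∧
      ∀ t x y, ‖x‖ ≤ R → ‖y‖ ≤ R → ‖g t x - g t y‖ ≤ L t * ‖x - y‖)
    (x₀ : E) {T : ℝ} (hT : 0 ≤ T) :
    ∃ y : ℝ → E, Continuous y ∧ (∀ t ≤ 0, y t = x₀) ∧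
      ∀ t ∈ Icc (0:ℝ) T, y t = x₀ + ∫ s in (0:ℝ)..t, g s (y s) := by
  set R := 2 * (1 + ‖x₀‖) * Real.exp (2 * ∫ r, k r) with hR
  have hR0 : 0 ≤ R := by positivity
  obtain ⟨L, hL, hL0, hLip⟩ := hlip (R + 1)
  let χ : E → ℝ := fun x => max 0 (min 1 (R + 1 - ‖x‖))
  have hχc : Continuous χ := by fun_prop
  have hχ0 : ∀ x, 0 ≤ χ x := fun x => le_max_left _ _
  have hχ1 : ∀ x, χ x ≤ 1 := fun x => max_le zero_le_one (min_le_left _ _)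
  have hχl : ∀ x y, |χ x - χ y| ≤ ‖x - y‖ := by
    intro x y
    have h1 : |(R + 1 - ‖x‖) - (R + 1 - ‖y‖)| ≤ ‖x - y‖ := by
      have := abs_norm_sub_norm_le y x
      rw [norm_sub_rev] at this
      convert this using 2; ring
    refine le_trans ?_ h1
    refine (abs_max_sub_max_le_max _ _ _ _).trans ?_
    refine max_le (by simp) ?_
    refine (abs_min_sub_min_le_max _ _ _ _).trans ?_
    exact max_le (by simp) le_rfl
  have hχout : ∀ x, R + 1 < ‖x‖ → χ x = 0 := by
    intro x hx
    exact max_eq_left ((min_le_right _ _).trans (by linarith))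
  have hχin : ∀ x, ‖x‖ ≤ R → χ x = 1 := by
    intro x hx
    simp only [χ]
    rw [min_eq_left (by linarith)]; simp
  have hb' : ∀ t x, ‖χ x • g t x‖ ≤ k t * (1 + ‖x‖) := by
    intro t x
    rw [norm_smul, Real.norm_of_nonneg (hχ0 x)]
    exact (mul_le_of_le_one_left (norm_nonneg _) (hχ1 x)).trans (hb t x)
  have hin : ∀ t x y, ‖x‖ ≤ R + 1 → ‖χ x • g t x - χ y • g t y‖ ≤
      (k t * (R + 2) + L t) * ‖x - y‖ := by
    intro t x y hx
    have h1 : χ x • g t x - χ y • g t y = (χ x - χ y) • g t x + χ y • (g t x - g t y) := by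
      rw [sub_smul, smul_sub]; abel
    have h2 : ‖(χ x - χ y) • g t x‖ ≤ k t * (R + 2) * ‖x - y‖ := by
      rw [norm_smul, Real.norm_eq_abs, mul_comm]
      refine mul_le_mul ((hb t x).trans ?_) (hχl x y) (abs_nonneg _) ?_
      · exact mul_le_mul_of_nonneg_left (by linarith) (hk0 t)
      · exact mul_nonneg (hk0 t) (by linarith)
    have h3 : ‖χ y • (g t x - g t y)‖ ≤ L t * ‖x - y‖ := by
      by_cases hy : ‖y‖ ≤ R + 1
      · rw [norm_smul, Real.norm_of_nonneg (hχ0 y)]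
        exact (mul_le_of_le_one_left (norm_nonneg _) (hχ1 y)).trans (hLip t x y hx hy)
      · rw [hχout y (not_le.1 hy)]
        simpa using mul_nonneg (hL0 t) (norm_nonneg (x - y))
    rw [h1]
    refine (norm_add_le _ _).trans ?_
    linarith
  have hLip' : ∀ t x y, ‖χ x • g t x - χ y • g t y‖ ≤ (k t * (R + 2) + L t) * ‖x - y‖ := by
    intro t x y
    by_cases hx : ‖x‖ ≤ R + 1
    · exact hin t x y hx
    by_cases hy : ‖y‖ ≤ R + 1
    · rw [norm_sub_rev, norm_sub_rev x y]
      exact hin t y x hy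
    · rw [hχout x (not_le.1 hx), hχout y (not_le.1 hy)]
      simp only [zero_smul, sub_zero, norm_zero]
      have := hk0 t
      have := hL0 t
      positivity
  obtain ⟨y, hyc, hy0, hy⟩ := dde_exist_lip (g := fun t x => χ x • g t x)
    (fun t => hχc.smul (hc t)) (fun x => (hm x).const_smul (χ x)) hk hb'
    (L := fun t => k t * (R + 2) + L t) ((hk.mul_const _).add hL)
    (fun t => add_nonneg (mul_nonneg (hk0 t) (by linarith)) (hL0 t)) hLip' x₀ hT
  have hbd := dde_apriori (g := fun t x => χ x • g t x) hk hk0 hb' x₀ hyc hy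
  refine ⟨y, hyc, hy0, fun t ht => ?_⟩
  rw [hy t ht]
  congr 1
  apply intervalIntegral.integral_congr
  intro s hs
  rw [uIcc_of_le ht.1] at hs
  simp only
  rw [hχin _ (hbd s ⟨hs.1, hs.2.trans ht.2⟩), one_smul]

theorem dde_unique {g : ℝ → E → E} (hc : ∀ t, Continuous (g t))
    (hm : ∀ x, Measurable fun t => g t x)
    {k : ℝ → ℝ} (hk : Integrable k)
    (hb : ∀ t x, ‖g t x‖ ≤ k t * (1 + ‖x‖))
    (hlip : ∀ R : ℝ, ∃ L : ℝ → ℝ, Integrable L ∧ (∀ t, 0 ≤ L t) ∧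
      ∀ t x y, ‖x‖ ≤ R → ‖y‖ ≤ R → ‖g t x - g t y‖ ≤ L t * ‖x - y‖)
    (x₀ : E) {T : ℝ} {x y : ℝ → E} (hx : Continuous x) (hy : Continuous y)
    (hxs : ∀ t ∈ Icc (0:ℝ) T, x t = x₀ + ∫ s in (0:ℝ)..t, g s (x s))
    (hys : ∀ t ∈ Icc (0:ℝ) T, y t = x₀ + ∫ s in (0:ℝ)..t, g s (y s)) :
    ∀ t ∈ Icc (0:ℝ) T, x t = y t := by
  obtain ⟨R₁, hR₁⟩ := isCompact_Icc.exists_bound_of_continuousOn (hx.continuousOn (s := Icc 0 T))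
  obtain ⟨R₂, hR₂⟩ := isCompact_Icc.exists_bound_of_continuousOn (hy.continuousOn (s := Icc 0 T))
  obtain ⟨L, hL, hL0, hLip⟩ := hlip (max R₁ R₂)
  have h0 := dde_gronwall (u := fun t => ‖x t - y t‖) (C := 0) (b := T) hL hL0 (by fun_prop) le_rfl
    (by
      intro t ht
      rw [hxs t ht, hys t ht, add_sub_add_left_eq_sub, ← intervalIntegral.integral_sub
        (dde_int hc hm hk hb hx _ _) (dde_int hc hm hk hb hy _ _), zero_add]
      refine intervalIntegral.norm_integral_le_of_norm_le ht.1
        (Filter.Eventually.of_forall fun s hs => ?_)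
        (hL.intervalIntegrable.mul_continuousOn (by fun_prop))
      have hs' : s ∈ Icc 0 T := ⟨hs.1.le, hs.2.trans ht.2⟩
      exact hLip s _ _ ((hR₁ s hs').trans (le_max_left _ _)) ((hR₂ s hs').trans (le_max_right _ _)))
  intro t ht
  have := h0 t ht
  simp only [mul_zero, zero_mul] at this
  exact sub_eq_zero.1 (norm_le_zero_iff.1 this)

/-- The delayed right-hand side, cut off outside `[0,T]`. -/
noncomputable def ddeG (f : ℝ → E → E → E) (T : ℝ) (z : ℝ → E) (s : ℝ) (v : E) : E :=
  (Icc (0:ℝ) T).indicator (fun s => f s v (z s)) s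

theorem ddeG_setup {f : ℝ → E → E → E} {T : ℝ} {K : ℝ → ℝ}
    (hA1 : ∀ t, Continuous fun xz : E × E => f t xz.1 xz.2)
    (hA2 : ∀ x z, Measurable fun t => f t x z)
    (hK0 : ∀ t, 0 ≤ K t) (hKint : IntegrableOn K (Icc (0:ℝ) T))
    (hA3 : ∀ t ∈ Icc (0:ℝ) T, ∀ x z : E, ‖f t x z‖ ≤ K t * (1 + ‖x‖) * (1 + ‖z‖))
    (hA4 : ∀ R : ℝ, ∃ L : ℝ → ℝ, (∀ t, 0 ≤ L t) ∧ IntegrableOn L (Icc (0:ℝ) T) ∧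
        ∀ t ∈ Icc (0:ℝ) T, ∀ x₁ x₂ : E, ‖x₁‖ ≤ R → ‖x₂‖ ≤ R → ∀ z : E,
          ‖f t x₁ z - f t x₂ z‖ ≤ L t * (1 + ‖z‖) * ‖x₁ - x₂‖)
    {z : ℝ → E} (hz : Continuous z) :
    (∀ t, Continuous (ddeG f T z t)) ∧ (∀ x, Measurable fun t => ddeG f T z t x) ∧
    (∃ k : ℝ → ℝ, Integrable k ∧ (∀ t, 0 ≤ k t) ∧
      ∀ t x, ‖ddeG f T z t x‖ ≤ k t * (1 + ‖x‖)) ∧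
    (∀ R : ℝ, ∃ L : ℝ → ℝ, Integrable L ∧ (∀ t, 0 ≤ L t) ∧
      ∀ t x y, ‖x‖ ≤ R → ‖y‖ ≤ R → ‖ddeG f T z t x - ddeG f T z t y‖ ≤ L t * ‖x - y‖) := by
  obtain ⟨B, hB⟩ := isCompact_Icc.exists_bound_of_continuousOn (hz.continuousOn (s := Icc 0 T))
  have hB' : ∀ t ∈ Icc (0:ℝ) T, 1 + ‖z t‖ ≤ 1 + |B| := fun t ht => by
    linarith [hB t ht, le_abs_self B]
  refine ⟨fun t => ?_, fun x => ?_, ?_, fun R => ?_⟩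
  · by_cases ht : t ∈ Icc (0:ℝ) T
    · have : ddeG f T z t = fun v => f t v (z t) := by
        funext v; simp [ddeG, indicator_of_mem ht]
      rw [this]
      exact (hA1 t).comp (continuous_id.prodMk continuous_const)
    · have : ddeG f T z t = fun v => 0 := by
        funext v; simp [ddeG, indicator_of_notMem ht]
      rw [this]
      exact continuous_const
  · refine Measurable.indicator ?_ measurableSet_Icc
    exact dde_meas (g := fun t w => f t x w)
      (fun t => (hA1 t).comp (continuous_const.prodMk continuous_id)) (fun w => hA2 x w)
      hz.measurable
  · refine ⟨fun t => (Icc (0:ℝ) T).indicator K t * (1 + |B|),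
      ((integrable_indicator_iff measurableSet_Icc).2 hKint).mul_const _, fun t => ?_,
      fun t x => ?_⟩
    · exact mul_nonneg (indicator_nonneg (fun t _ => hK0 t) t) (by positivity)
    · by_cases ht : t ∈ Icc (0:ℝ) T
      · simp only [ddeG, indicator_of_mem ht]
        refine (hA3 t ht _ _).trans ?_
        have := mul_le_mul_of_nonneg_left (hB' t ht)
          (mul_nonneg (hK0 t) (by positivity : 0 ≤ 1 + ‖x‖))
        linarith
      · simp [ddeG, indicator_of_notMem ht]
  · obtain ⟨L, hL0, hL, hLip⟩ := hA4 R
    refine ⟨fun t => (Icc (0:ℝ) T).indicator L t * (1 + |B|),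
      ((integrable_indicator_iff measurableSet_Icc).2 hL).mul_const _, fun t => ?_,
      fun t x y hx hy => ?_⟩
    · exact mul_nonneg (indicator_nonneg (fun t _ => hL0 t) t) (by positivity)
    · by_cases ht : t ∈ Icc (0:ℝ) T
      · simp only [ddeG, indicator_of_mem ht]
        refine (hLip t ht _ _ hx hy _).trans ?_
        exact mul_le_mul_of_nonneg_right (mul_le_mul_of_nonneg_left (hB' t ht) (hL0 t))
          (norm_nonneg _)
      · simp [ddeG, indicator_of_notMem ht]

theorem ddeG_integral (f : ℝ → E → E → E) {T t : ℝ} (z x : ℝ → E) (ht : t ∈ Icc (0:ℝ) T) :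
    ∫ s in (0:ℝ)..t, ddeG f T z s (x s) = ∫ s in (0:ℝ)..t, f s (x s) (z s) := by
  apply intervalIntegral.integral_congr
  intro s hs
  rw [uIcc_of_le ht.1] at hs
  have : s ∈ Icc 0 T := ⟨hs.1, hs.2.trans ht.2⟩
  simp [ddeG, indicator_of_mem this]

theorem dde_main {f : ℝ → E → E → E} {τ : ℝ} (hτ : 0 < τ) (n : ℕ) {T : ℝ} (hTn : T = (n + 1) * τ)
    {K : ℝ → ℝ} (x₀ : E)
    (hA1 : ∀ t, Continuous fun xz : E × E => f t xz.1 xz.2)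
    (hA2 : ∀ x z, Measurable fun t => f t x z)
    (hK0 : ∀ t, 0 ≤ K t) (hKint : IntegrableOn K (Icc (0:ℝ) T))
    (hA3 : ∀ t ∈ Icc (0:ℝ) T, ∀ x z : E, ‖f t x z‖ ≤ K t * (1 + ‖x‖) * (1 + ‖z‖))
    (hA4 : ∀ R : ℝ, ∃ L : ℝ → ℝ, (∀ t, 0 ≤ L t) ∧ IntegrableOn L (Icc (0:ℝ) T) ∧
        ∀ t ∈ Icc (0:ℝ) T, ∀ x₁ x₂ : E, ‖x₁‖ ≤ R → ‖x₂‖ ≤ R → ∀ z : E,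
          ‖f t x₁ z - f t x₂ z‖ ≤ L t * (1 + ‖z‖) * ‖x₁ - x₂‖) :
    (∃ x : ℝ → E, Continuous x ∧ (∀ t ≤ 0, x t = x₀) ∧
      IntegrableOn (fun s => f s (x s) (x (s - τ))) (Icc (0:ℝ) T) ∧
      ∀ t ∈ Icc (0:ℝ) T, x t = x₀ + ∫ s in (0:ℝ)..t, f s (x s) (x (s - τ))) ∧
    (∀ x y : ℝ → E, Continuous x → Continuous y → (∀ t ≤ 0, x t = x₀) → (∀ t ≤ 0, y t = x₀) →
      (∀ t ∈ Icc (0:ℝ) T, x t = x₀ + ∫ s in (0:ℝ)..t, f s (x s) (x (s - τ))) →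
      (∀ t ∈ Icc (0:ℝ) T, y t = x₀ + ∫ s in (0:ℝ)..t, f s (y s) (y (s - τ))) →
      ∀ t ≤ T, x t = y t) := by
  have hT0 : 0 ≤ T := by rw [hTn]; positivity
  have setup := fun {z : ℝ → E} (hz : Continuous z) =>
    ddeG_setup (T := T) hA1 hA2 hK0 hKint hA3 hA4 hz
  have hex : ∀ z : ℝ → E, Continuous z → ∃ y : ℝ → E, Continuous y ∧ (∀ t ≤ 0, y t = x₀) ∧
      ∀ t ∈ Icc (0:ℝ) T, y t = x₀ + ∫ s in (0:ℝ)..t, f s (y s) (z s) := by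
    intro z hz
    obtain ⟨h1, h2, ⟨k, hk, hk0, hb⟩, h4⟩ := setup hz
    obtain ⟨y, hy, hy0, hys⟩ := dde_exist h1 h2 hk hk0 hb h4 x₀ hT0
    exact ⟨y, hy, hy0, fun t ht => by rw [← ddeG_integral f z y ht]; exact hys t ht⟩
  have huniq : ∀ z₁ z₂ x y : ℝ → E, Continuous z₁ → Continuous x → Continuous y →
      (∀ t ∈ Icc (0:ℝ) T, x t = x₀ + ∫ s in (0:ℝ)..t, f s (x s) (z₁ s)) →
      (∀ t ∈ Icc (0:ℝ) T, y t = x₀ + ∫ s in (0:ℝ)..t, f s (y s) (z₂ s)) →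
      ∀ t ∈ Icc (0:ℝ) T, (∀ s ∈ Icc (0:ℝ) t, z₁ s = z₂ s) → x t = y t := by
    intro z₁ z₂ x y hz hx hy hxs hys t ht hzz
    obtain ⟨h1, h2, ⟨k, hk, hk0, hb⟩, h4⟩ := setup hz
    refine dde_unique (T := t) h1 h2 hk hb h4 x₀ hx hy ?_ ?_ t ⟨ht.1, le_rfl⟩
    · intro r hr
      have hr' : r ∈ Icc 0 T := ⟨hr.1, hr.2.trans ht.2⟩
      rw [ddeG_integral f z₁ x hr']; exact hxs r hr'
    · intro r hr
      have hr' : r ∈ Icc 0 T := ⟨hr.1, hr.2.trans ht.2⟩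
      rw [ddeG_integral f z₁ y hr', hys r hr']
      congr 1
      apply intervalIntegral.integral_congr
      intro s hs
      rw [uIcc_of_le hr.1] at hs
      simp only
      rw [hzz s ⟨hs.1, hs.2.trans hr.2⟩]
  have hsh : Continuous fun s : ℝ => s - τ := by fun_prop
  constructor
  · choose S hSc hS0 hSs using hex
    let X : ℕ → {y : ℝ → E // Continuous y} := fun j => Nat.rec ⟨fun _ => x₀, continuous_const⟩
      (fun _ y => ⟨S (fun s => y.1 (s - τ)) (y.2.comp hsh), hSc _ _⟩) j
    have hX0 : ∀ j, ∀ t ≤ 0, (X j).1 t = x₀ := by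
      intro j t ht
      cases j with
      | zero => rfl
      | succ j => exact hS0 _ _ t ht
    have hXs : ∀ j, ∀ t ∈ Icc (0:ℝ) T, (X (j+1)).1 t =
        x₀ + ∫ s in (0:ℝ)..t, f s ((X (j+1)).1 s) ((X j).1 (s - τ)) := by
      intro j t ht
      exact hSs _ ((X j).2.comp hsh) t ht
    have hXX : ∀ j : ℕ, ∀ t : ℝ, t ≤ j * τ → t ≤ T → (X j).1 t = (X (j+1)).1 t := by
      intro j
      induction j with
      | zero =>
        intro t ht _
        have ht : t ≤ 0 := by simpa using ht
        exact (hX0 0 t ht).trans (hX0 1 t ht).symm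
      | succ j ih =>
        intro t ht htT
        rcases le_total t 0 with h0 | h0
        · exact (hX0 (j+1) t h0).trans (hX0 (j+1+1) t h0).symm
        · refine huniq _ _ _ _ ((X j).2.comp hsh) (X (j+1)).2 (X (j+1+1)).2
            (hXs j) (hXs (j+1)) t ⟨h0, htT⟩ ?_
          intro s hs
          refine ih (s - τ) ?_ ?_
          · push_cast at ht
            linarith [hs.2]
          · linarith [hs.2]
    have hfin : ∀ s ∈ Icc (0:ℝ) T, (X n).1 (s - τ) = (X (n+1)).1 (s - τ) := by
      intro s hs
      refine hXX n _ ?_ ?_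
      · have := hs.2
        rw [hTn] at this
        linarith
      · linarith [hs.2]
    refine ⟨(X (n+1)).1, (X (n+1)).2, hX0 (n+1), ?_, ?_⟩
    · obtain ⟨h1, h2, ⟨k, hk, hk0, hb⟩, h4⟩ := setup ((X (n+1)).2.comp hsh)
      have := dde_int h1 h2 hk hb (X (n+1)).2 0 T
      rw [intervalIntegrable_iff_integrableOn_Icc_of_le hT0] at this
      refine this.congr_fun ?_ measurableSet_Icc
      intro s hs
      simp [ddeG, indicator_of_mem hs]
    · intro t ht
      rw [hXs n t ht]
      congr 1
      apply intervalIntegral.integral_congr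
      intro s hs
      rw [uIcc_of_le ht.1] at hs
      simp only
      rw [hfin s ⟨hs.1, hs.2.trans ht.2⟩]
  · intro x y hx hy hx0 hy0 hxs hys
    have key : ∀ j : ℕ, ∀ t : ℝ, t ≤ j * τ → t ≤ T → x t = y t := by
      intro j
      induction j with
      | zero =>
        intro t ht _
        have ht : t ≤ 0 := by simpa using ht
        rw [hx0 t ht, hy0 t ht]
      | succ j ih =>
        intro t ht htT
        rcases le_total t 0 with h0 | h0
        · rw [hx0 t h0, hy0 t h0]
        · refine huniq _ _ _ _ (hx.comp hsh) hx hy hxs hys t ⟨h0, htT⟩ ?_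
          intro s hs
          refine ih (s - τ) ?_ ?_
          · push_cast at ht
            linarith [hs.2]
          · linarith [hs.2]
    intro t ht
    refine key (n+1) t ?_ ht
    push_cast
    linarith

/-- A solution in the integrated sense agrees with a globally continuous one. -/
theorem dde_regularize {f : ℝ → E → E → E} {τ : ℝ} (hτ : 0 < τ) {T : ℝ} (x₀ : E) {x : ℝ → E}
    (h0 : ∀ t ∈ Icc (-τ) (0:ℝ), x t = x₀)
    (hi : IntegrableOn (fun s => f s (x s) (x (s - τ))) (Icc (0:ℝ) T))
    (hs : ∀ t ∈ Icc (0:ℝ) T, x t = x₀ + ∫ s in (0:ℝ)..t, f s (x s) (x (s - τ))) :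
    ∃ x' : ℝ → E, Continuous x' ∧ (∀ t ≤ 0, x' t = x₀) ∧ EqOn x x' (Icc (-τ) T) ∧
      ∀ t ∈ Icc (0:ℝ) T, x' t = x₀ + ∫ s in (0:ℝ)..t, f s (x' s) (x' (s - τ)) := by
  let φ : ℝ → E := (Icc (0:ℝ) T).indicator fun s => f s (x s) (x (s - τ))
  have hφ : Integrable φ := (integrable_indicator_iff measurableSet_Icc).2 hi
  let x' : ℝ → E := fun t => x₀ + ∫ s in (0:ℝ)..t, φ s
  have hc : Continuous x' := continuous_const.add
    (intervalIntegral.continuous_primitive (fun _ _ => hφ.intervalIntegrable) 0)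
  have h0' : ∀ t ≤ 0, x' t = x₀ := by
    intro t ht
    have : ∫ s in (0:ℝ)..t, φ s = 0 := by
      rw [intervalIntegral.integral_symm, intervalIntegral.integral_of_le ht,
        integral_Ioc_eq_integral_Ioo, setIntegral_eq_zero_of_forall_eq_zero, neg_zero]
      intro s hs
      have hs' : s ∉ Icc (0:ℝ) T := fun h => by linarith [h.1, hs.2]
      simp only [φ, indicator_of_notMem hs']
    simp only [x', this, add_zero]
  have heq : EqOn x x' (Icc (-τ) T) := by
    intro t ht
    rcases le_total t 0 with h | h
    · rw [h0 t ⟨ht.1, h⟩, h0' t h]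
    · rw [hs t ⟨h, ht.2⟩]
      simp only [x']
      congr 1
      apply intervalIntegral.integral_congr
      intro s hs
      rw [uIcc_of_le h] at hs
      have hs' : s ∈ Icc (0:ℝ) T := ⟨hs.1, hs.2.trans ht.2⟩
      simp only [φ, indicator_of_mem hs']
  refine ⟨x', hc, h0', heq, fun t ht => ?_⟩
  rw [← heq ⟨by linarith [ht.1], ht.2⟩, hs t ht]
  congr 1
  apply intervalIntegral.integral_congr
  intro s hs
  rw [uIcc_of_le ht.1] at hs
  simp only
  rw [heq ⟨by linarith [hs.1], hs.2.trans ht.2⟩,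
    heq ⟨by linarith [hs.1], by linarith [hs.2, ht.2]⟩]

end

theorem stmt10 (d n : ℕ) (τ : ℝ) (hτ : 0 < τ)
    (f : ℝ → EuclideanSpace ℝ (Fin d) → EuclideanSpace ℝ (Fin d) → EuclideanSpace ℝ (Fin d))
    (x₀ : EuclideanSpace ℝ (Fin d)) (K : ℝ → ℝ)
    -- (A1)
    (hA1 : ∀ t, Continuous fun xz : EuclideanSpace ℝ (Fin d) × EuclideanSpace ℝ (Fin d) =>
      f t xz.1 xz.2)
    -- (A2)
    (hA2 : ∀ x z, Measurable fun t => f t x z)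
    -- (A3)
    (hK0 : ∀ t, 0 ≤ K t) (hKint : IntegrableOn K (Icc (0:ℝ) ((n+1)*τ)))
    (hA3 : ∀ t ∈ Icc (0:ℝ) ((n+1)*τ), ∀ x z : EuclideanSpace ℝ (Fin d),
      ‖f t x z‖ ≤ K t * (1 + ‖x‖) * (1 + ‖z‖))
    -- (A4)
    (hA4 : ∀ U : Set (EuclideanSpace ℝ (Fin d)), IsCompact U →
      ∃ L : ℝ → ℝ, (∀ t, 0 ≤ L t) ∧ IntegrableOn L (Icc (0:ℝ) ((n+1)*τ)) ∧
        ∀ t ∈ Icc (0:ℝ) ((n+1)*τ), ∀ x₁ ∈ U, ∀ x₂ ∈ U, ∀ z : EuclideanSpace ℝ (Fin d),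
          ‖f t x₁ z - f t x₂ z‖ ≤ L t * (1 + ‖z‖) * ‖x₁ - x₂‖) :
    (∃ x, IsDDESolution d n τ f x₀ x ∧ ContinuousOn x (Icc (-τ) ((n+1)*τ))) ∧
    (∀ x y, IsDDESolution d n τ f x₀ x → IsDDESolution d n τ f x₀ y →
      EqOn x y (Icc (-τ) ((n+1)*τ))) := by
  have hmain := dde_main hτ n rfl x₀ hA1 hA2 hK0 hKint hA3 (fun R => by
    obtain ⟨L, hL0, hL, hLip⟩ := hA4 (Metric.closedBall 0 R) (isCompact_closedBall 0 R)
    refine ⟨L, hL0, hL, fun t ht x₁ x₂ h1 h2 z => ?_⟩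
    exact hLip t ht x₁ (by simpa using h1) x₂ (by simpa using h2) z)
  obtain ⟨⟨x, hxc, hx0, hxi, hxs⟩, huniq⟩ := hmain
  refine ⟨⟨x, ⟨fun t ht => hx0 t ht.2, hxi, hxs⟩, hxc.continuousOn⟩, ?_⟩
  rintro x y ⟨hx0, hxi, hxs⟩ ⟨hy0, hyi, hys⟩ t ht
  obtain ⟨x', hx'c, hx'0, hxx, hx's⟩ := dde_regularize hτ x₀ hx0 hxi hxs
  obtain ⟨y', hy'c, hy'0, hyy, hy's⟩ := dde_regularize hτ x₀ hy0 hyi hys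
  rw [hxx ht, hyy ht]
  exact huniq x' y' hx'c hy'c hx'0 hy'0 hx's hy's t ht.2
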